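/- Let α ∈ [0,1) and let m ≥ 4 be an integer with (m−2)(m−3)/(m−1)² > α. Let μ := μ(α), let X be the set of maximizers defining μ(α), and let R := max{ z₂³ : z ∈ X }. Then as η → 0⁺, ψ_{α+η}(μ) ≤ μ + R·η + o(η); that is, limsup_{η→0⁺} (ψ_{α+η}(μ) − μ − R·η)/η ≤ 0. -/

import Mathlib

open Filter

/-- `g_m(z) = 6·Σ_{a<b<c} z_a z_b z_c`, the Lagrangian polynomial of the complete
`3`-graph on `m` vertices. -/
noncomputable def gPoly (m : ℕ) (z : Fin m → ℝ) : ℝ :=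
  6 * ∑ e ∈ Finset.powersetCard 3 (Finset.univ : Finset (Fin m)), ∏ i ∈ e, z i

/-- `ψ_b(t) = max_{z∈Δ_{m−1}} ( g_m(z) + t·z₁³ + b·z₂³ )`. -/
noncomputable def psi (m : ℕ) (hm : 3 ≤ m) (b t : ℝ) : ℝ :=
  sSup { v : ℝ | ∃ z ∈ stdSimplex ℝ (Fin m),
    v = gPoly m z + t * z ⟨0, by omega⟩ ^ 3 + b * z ⟨1, by omega⟩ ^ 3 }

/-- `μ(a) = max { (g_m(z) + a·z₂³)/(1 − z₁³) : z ∈ Δ_{m−1}, z₁ < 1 }`. -/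
noncomputable def muFun (m : ℕ) (hm : 3 ≤ m) (a : ℝ) : ℝ :=
  sSup { v : ℝ | ∃ z ∈ stdSimplex ℝ (Fin m), z ⟨0, by omega⟩ < 1 ∧
    v = (gPoly m z + a * z ⟨1, by omega⟩ ^ 3) / (1 - z ⟨0, by omega⟩ ^ 3) }

/-- The set `X` of maximizers in the definition of `μ(a)`. -/
def Xset (m : ℕ) (hm : 3 ≤ m) (a : ℝ) : Set (Fin m → ℝ) :=
  { z | z ∈ stdSimplex ℝ (Fin m) ∧ z ⟨0, by omega⟩ < 1 ∧
    (gPoly m z + a * z ⟨1, by omega⟩ ^ 3) / (1 - z ⟨0, by omega⟩ ^ 3) = muFun m hm a }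

lemma continuous_gPoly (m : ℕ) : Continuous (gPoly m) := by
  unfold gPoly
  fun_prop

lemma add_le_one_of_mem_stdSimplex {ι : Type*} [Fintype ι] {z : ι → ℝ}
    (hz : z ∈ stdSimplex ℝ ι) {i j : ι} (hij : i ≠ j) : z i + z j ≤ 1 := by
  classical
  rw [← hz.2, ← Finset.sum_pair hij]
  exact Finset.sum_le_sum_of_subset_of_nonneg (Finset.subset_univ _) fun k _ _ => hz.1 k

lemma le_one_of_mem_stdSimplex {ι : Type*} [Fintype ι] {z : ι → ℝ}
    (hz : z ∈ stdSimplex ℝ ι) (i : ι) : z i ≤ 1 :=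
  (mem_Icc_of_mem_stdSimplex hz i).2

/-- Every monomial of `gPoly` involves a variable other than `z i`. -/
lemma gPoly_le {m : ℕ} {z : Fin m → ℝ} (hz : z ∈ stdSimplex ℝ (Fin m)) (i : Fin m) :
    gPoly m z ≤ 6 * m.choose 3 * (1 - z i) := by
  have hprod : ∀ e ∈ Finset.powersetCard 3 (Finset.univ : Finset (Fin m)),
      ∏ k ∈ e, z k ≤ 1 - z i := by
    intro e he
    rw [Finset.mem_powersetCard] at he
    obtain ⟨j, hj, hji⟩ := Finset.exists_mem_ne (by omega : 1 < e.card) i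
    rw [← Finset.mul_prod_erase e z hj]
    have hle : ∏ k ∈ e.erase j, z k ≤ 1 :=
      Finset.prod_le_one (fun k _ => hz.1 k) fun k _ => le_one_of_mem_stdSimplex hz k
    have := mul_le_of_le_one_right (hz.1 j) hle
    have := add_le_one_of_mem_stdSimplex hz hji
    linarith
  have hsum := Finset.sum_le_card_nsmul _ _ _ hprod
  rw [Finset.card_powersetCard, Finset.card_fin, nsmul_eq_mul] at hsum
  unfold gPoly
  linarith

lemma gPoly_single (m : ℕ) (i : Fin m) : gPoly m (Pi.single i 1) = 0 := by
  unfold gPoly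
  rw [Finset.sum_eq_zero, mul_zero]
  intro e he
  rw [Finset.mem_powersetCard] at he
  obtain ⟨j, hj, hji⟩ := Finset.exists_mem_ne (by omega : 1 < e.card) i
  exact Finset.prod_eq_zero hj (by simp [hji])

section

variable {m : ℕ} (hm : 3 ≤ m) {a : ℝ}

/-- The ratios defining `muFun` are bounded above. -/
lemma bddAbove_muFun (ha : 0 ≤ a) :
    BddAbove { v : ℝ | ∃ z ∈ stdSimplex ℝ (Fin m), z ⟨0, by omega⟩ < 1 ∧
      v = (gPoly m z + a * z ⟨1, by omega⟩ ^ 3) / (1 - z ⟨0, by omega⟩ ^ 3) } := by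
  refine ⟨6 * m.choose 3 + a, ?_⟩
  rintro v ⟨z, hz, hz0, rfl⟩
  have h0 := hz.1 ⟨0, by omega⟩
  have h1 := hz.1 ⟨1, by omega⟩
  have hsum := add_le_one_of_mem_stdSimplex hz
    (show (⟨0, by omega⟩ : Fin m) ≠ ⟨1, by omega⟩ by simp)
  have hg := gPoly_le hz ⟨0, by omega⟩
  set x := z ⟨0, by omega⟩
  set y := z ⟨1, by omega⟩
  have hx3 : x ^ 3 ≤ x := pow_le_of_le_one h0 hz0.le (by norm_num)
  have hy3 : y ^ 3 ≤ y := pow_le_of_le_one h1 (by linarith) (by norm_num)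
  have hc : (0 : ℝ) ≤ 6 * m.choose 3 + a := by positivity
  rw [div_le_iff₀ (by linarith)]
  calc gPoly m z + a * y ^ 3 ≤ 6 * m.choose 3 * (1 - x) + a * (1 - x) := by
        gcongr
        linarith
    _ = (6 * m.choose 3 + a) * (1 - x) := by ring
    _ ≤ (6 * m.choose 3 + a) * (1 - x ^ 3) := by gcongr

/-- At `t = muFun m hm a`, the objective defining `psi m hm a t` is at most `t`. -/
lemma objective_le_muFun (ha : 0 ≤ a) {z : Fin m → ℝ} (hz : z ∈ stdSimplex ℝ (Fin m)) :
    gPoly m z + muFun m hm a * z ⟨0, by omega⟩ ^ 3 + a * z ⟨1, by omega⟩ ^ 3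
      ≤ muFun m hm a := by
  have h1 := hz.1 ⟨1, by omega⟩
  rcases (le_one_of_mem_stdSimplex hz ⟨0, by omega⟩).lt_or_eq with hlt | heq
  · have hle := le_csSup (bddAbove_muFun hm ha) ⟨z, hz, hlt, rfl⟩
    have hpos : 0 < 1 - z ⟨0, by omega⟩ ^ 3 :=
      sub_pos.2 (pow_lt_one₀ (hz.1 _) hlt (by norm_num))
    rw [div_le_iff₀ hpos] at hle
    change _ ≤ muFun m hm a * _ at hle
    linarith
  · have hsum := add_le_one_of_mem_stdSimplex hz
      (show (⟨0, by omega⟩ : Fin m) ≠ ⟨1, by omega⟩ by simp)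
    have hg := gPoly_le hz ⟨0, by omega⟩
    have hy : z ⟨1, by omega⟩ = 0 := by linarith
    rw [heq] at hg ⊢
    rw [hy]
    linarith

/-- A point of the simplex with `z₁ < 1` at which the objective attains `muFun m hm a` is a
maximizer of the ratio. -/
lemma mem_Xset_of_objective_eq {z : Fin m → ℝ} (hz : z ∈ stdSimplex ℝ (Fin m))
    (hlt : z ⟨0, by omega⟩ < 1)
    (h : gPoly m z + muFun m hm a * z ⟨0, by omega⟩ ^ 3 + a * z ⟨1, by omega⟩ ^ 3
      = muFun m hm a) : z ∈ Xset m hm a := by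
  have hpos : 0 < 1 - z ⟨0, by omega⟩ ^ 3 :=
    sub_pos.2 (pow_lt_one₀ (hz.1 _) hlt (by norm_num))
  refine ⟨hz, hlt, ?_⟩
  rw [div_eq_iff hpos.ne']
  linarith

/-- On points whose `z₂³` exceeds its maximum over `Xset` by at least `ε`, the objective stays
uniformly below `muFun m hm a`. -/
lemma exists_gap (ha : 0 ≤ a) {R : ℝ} (hR0 : 0 ≤ R)
    (hR : ∀ z ∈ Xset m hm a, z ⟨1, by omega⟩ ^ 3 ≤ R) {ε : ℝ} (hε : 0 < ε) :
    ∃ δ > 0, ∀ z ∈ stdSimplex ℝ (Fin m), R + ε ≤ z ⟨1, by omega⟩ ^ 3 →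
      gPoly m z + muFun m hm a * z ⟨0, by omega⟩ ^ 3 + a * z ⟨1, by omega⟩ ^ 3
        ≤ muFun m hm a - δ := by
  set K := stdSimplex ℝ (Fin m) ∩ { z | R + ε ≤ z ⟨1, by omega⟩ ^ 3 }
  have hK : IsCompact K :=
    (isCompact_stdSimplex ℝ (Fin m)).inter_right
      (isClosed_le continuous_const (by fun_prop))
  rcases K.eq_empty_or_nonempty with hemp | hne
  · exact ⟨1, one_pos, fun z hz hzR =>
      (hemp.subset (show z ∈ K from ⟨hz, hzR⟩)).elim⟩
  have hcont : Continuous fun z : Fin m → ℝ =>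
      gPoly m z + muFun m hm a * z ⟨0, by omega⟩ ^ 3 + a * z ⟨1, by omega⟩ ^ 3 := by
    have := continuous_gPoly m
    fun_prop
  obtain ⟨w, ⟨hw, hwR⟩, hmax⟩ := hK.exists_isMaxOn hne hcont.continuousOn
  refine ⟨_, sub_pos.2 ((objective_le_muFun hm ha hw).lt_of_ne fun heq => ?_),
    fun z hz hzR => ?_⟩
  · have hwR : R + ε ≤ w ⟨1, by omega⟩ ^ 3 := hwR
    have hy : 0 < w ⟨1, by omega⟩ :=
      (hw.1 _).lt_of_ne fun h => by rw [← h] at hwR; norm_num at hwR; linarith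
    have hsum := add_le_one_of_mem_stdSimplex hw
      (show (⟨0, by omega⟩ : Fin m) ≠ ⟨1, by omega⟩ by simp)
    have := hR w (mem_Xset_of_objective_eq hm hw (by linarith) heq)
    linarith
  · have := hmax (show z ∈ K from ⟨hz, hzR⟩)
    simp only [Set.mem_ofPred_eq] at this
    linarith

lemma psi_le {b t M : ℝ}
    (h : ∀ z ∈ stdSimplex ℝ (Fin m),
      gPoly m z + t * z ⟨0, by omega⟩ ^ 3 + b * z ⟨1, by omega⟩ ^ 3 ≤ M) :
    psi m hm b t ≤ M := by
  refine csSup_le ⟨_, _, single_mem_stdSimplex ℝ ⟨0, by omega⟩, rfl⟩ ?_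
  rintro v ⟨z, hz, rfl⟩
  exact h z hz

lemma le_psi_of_objective_le {b t M : ℝ}
    (h : ∀ z ∈ stdSimplex ℝ (Fin m),
      gPoly m z + t * z ⟨0, by omega⟩ ^ 3 + b * z ⟨1, by omega⟩ ^ 3 ≤ M) :
    t ≤ psi m hm b t := by
  refine le_csSup ⟨M, ?_⟩ ⟨_, single_mem_stdSimplex ℝ ⟨0, by omega⟩, ?_⟩
  · rintro v ⟨z, hz, rfl⟩
    exact h z hz
  · simp [gPoly_single]

end

/-- One-step estimate: with `μ := μ(α)` and `R := max{ z₂³ : z ∈ X }`, we have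
`ψ_{α+η}(μ) ≤ μ + R·η + o(η)` as `η → 0⁺`, i.e.
`limsup_{η→0⁺} (ψ_{α+η}(μ) − μ − R·η)/η ≤ 0`. -/
theorem one_step_estimate (m : ℕ) (hm : 3 ≤ m) (hm4 : 4 ≤ m) (α : ℝ)
    (hα : α ∈ Set.Ico (0 : ℝ) 1)
    (hgap : α < ((m : ℝ) - 2) * ((m : ℝ) - 3) / ((m : ℝ) - 1) ^ 2)
    (R : ℝ)
    (hR : IsGreatest ((fun z : Fin m → ℝ => z ⟨1, by omega⟩ ^ 3) '' Xset m hm α) R) :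
    Filter.limsup
      (fun η => (psi m hm (α + η) (muFun m hm α) - muFun m hm α - R * η) / η)
      (nhdsWithin 0 (Set.Ioi 0)) ≤ 0 := by
  have hR0 : 0 ≤ R := by
    obtain ⟨z, hz, rfl⟩ := hR.1
    exact pow_nonneg (hz.1.1 _) 3
  have hRX : ∀ z ∈ Xset m hm α, z ⟨1, by omega⟩ ^ 3 ≤ R := fun z hz => hR.2 ⟨z, hz, rfl⟩
  have hcube : ∀ z ∈ stdSimplex ℝ (Fin m), z ⟨1, by omega⟩ ^ 3 ≤ 1 := fun z hz =>
    pow_le_one₀ (hz.1 _) (le_one_of_mem_stdSimplex hz _)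
  have hlower : ∀ᶠ η in nhdsWithin (0 : ℝ) (Set.Ioi 0),
      -R ≤ (psi m hm (α + η) (muFun m hm α) - muFun m hm α - R * η) / η := by
    filter_upwards [self_mem_nhdsWithin] with η (hη : 0 < η)
    have := le_psi_of_objective_le hm (b := α + η) (t := muFun m hm α)
      (M := muFun m hm α + η) fun z hz => by
        have := objective_le_muFun hm hα.1 hz
        have := mul_le_of_le_one_right hη.le (hcube z hz)
        linarith
    rw [le_div_iff₀ hη]
    linarith
  refine le_of_forall_pos_le_add fun ε hε => ?_
  rw [zero_add]
  refine limsup_le_of_le (isCoboundedUnder_le_of_eventually_le _ hlower) ?_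
  obtain ⟨δ, hδ, hgapδ⟩ := exists_gap hm hα.1 hR0 hRX hε
  filter_upwards [Ioo_mem_nhdsGT hδ] with η hη
  have hη0 : 0 < η := hη.1
  rw [div_le_iff₀ hη0]
  suffices psi m hm (α + η) (muFun m hm α) ≤ muFun m hm α + (R + ε) * η by linarith
  refine psi_le hm fun z hz => ?_
  rcases le_total (R + ε) (z ⟨1, by omega⟩ ^ 3) with hzR | hzR
  · have := hgapδ z hz hzR
    have := mul_le_of_le_one_right hη0.le (hcube z hz)
    have : 0 ≤ (R + ε) * η := by positivity
    linarith [hη.2]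
  · have := objective_le_muFun hm hα.1 hz
    have := mul_le_mul_of_nonneg_right hzR hη0.le
    linarith
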